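/- arXiv:2601.14928 — 2 statements merged into one kernel-verified Lean document; each statement's English description precedes it below -/
import Mathlib

section
/- Let (Ω,d_Ω) and (Y,d_Y) be complete separable metric spaces, σ a Borel probability measure on Ω, and fix y0 ∈ Y. Fix 1 ≤ p < ∞, 1 ≤ q ≤ ∞, an integer K ≥ 2, weights λ_1,…,λ_K ∈ (0,1) with Σ_k λ_k = 1, and μ_1,…,μ_K ∈ 𝒫_p(Y). If ν_0 ∈ 𝒫_p(Y) minimizes ν ↦ Σ_{k=1}^K λ_k MK_p(μ_k, ν) over 𝒫_p(Y), then the product measure σ ⊗ ν_0 belongs to 𝒫^σ_{p,q}(Ω×Y) and minimizes n ↦ Σ_{k=1}^K λ_k scrMK_{p,q}(σ ⊗ μ_k, n) over 𝒫^σ_{p,q}(Ω×Y). -/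
open MeasureTheory ProbabilityTheory ENNReal

/-- The `p`-Monge–Kantorovich (Wasserstein) distance between two measures on a metric
space: the infimum over all couplings `γ` of `μ` and `ν` of the `L^p(γ)`-norm of the
distance function. -/
noncomputable def MK {X : Type*} [PseudoEMetricSpace X] [MeasurableSpace X] (p : ℝ)
    (μ ν : Measure X) : ℝ≥0∞ :=
  ⨅ (γ : Measure (X × X)) (_ : γ.map Prod.fst = μ ∧ γ.map Prod.snd = ν),
    (∫⁻ z, edist z.1 z.2 ^ p ∂γ) ^ (1 / p)

/-- The disintegrated `(p,q)`-Monge–Kantorovich distance on the trivial bundle `Ω × Y`,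
expressed in terms of the fiberwise disintegrations (Markov kernels) `κ`, `η` of the two
measures: the `L^q(σ)`-norm of `ω ↦ MK_p(κ ω, η ω)`. -/
noncomputable def scrMK {Ω Y : Type*} [MeasurableSpace Ω] [PseudoEMetricSpace Y]
    [MeasurableSpace Y] (p : ℝ) (q : ℝ≥0∞) (σ : Measure Ω) (κ η : Kernel Ω Y) : ℝ≥0∞ :=
  if q = ∞ then essSup (fun ω => MK p (κ ω) (η ω)) σ
  else (∫⁻ ω, MK p (κ ω) (η ω) ^ q.toReal ∂σ) ^ (1 / q.toReal)

/-- Membership in `𝒫^σ_{p,q}(Ω × Y)`, with a measure on `Ω × Y` with first marginal `σ`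
encoded by its disintegration: a Markov kernel `κ : Ω → 𝒫(Y)` such that the disintegrated
`(p,q)`-distance to the fiberwise Dirac measure `σ ⊗ δ_{y0}` is finite. -/
def MemP {Ω Y : Type*} [MeasurableSpace Ω] [PseudoEMetricSpace Y] [MeasurableSpace Y]
    (p : ℝ) (q : ℝ≥0∞) (σ : Measure Ω) (y0 : Y) (κ : Kernel Ω Y) : Prop :=
  IsMarkovKernel κ ∧ scrMK p q σ (Kernel.const Ω (Measure.dirac y0)) κ ≠ ∞

/-- `μ` has finite `p`-th moment about the point `x0`. -/
def FiniteMoment {X : Type*} [PseudoEMetricSpace X] [MeasurableSpace X] (p : ℝ) (x0 : X)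
    (μ : Measure X) : Prop :=
  ∫⁻ x, edist x0 x ^ p ∂μ ≠ ∞

section Aux

open Filter Topology

variable {Y : Type*} [MetricSpace Y] [CompleteSpace Y] [SecondCountableTopology Y]
    [MeasurableSpace Y] [BorelSpace Y]

theorem MK_le_of_coupling {p : ℝ} {μ ν : Measure Y} (γ : Measure (Y × Y))
    (h1 : γ.map Prod.fst = μ) (h2 : γ.map Prod.snd = ν) :
    MK p μ ν ≤ (∫⁻ z, edist z.1 z.2 ^ p ∂γ) ^ (1 / p) :=
  iInf₂_le γ ⟨h1, h2⟩

theorem measurable_cost {p : ℝ} : Measurable (fun z : Y × Y => edist z.1 z.2 ^ p) :=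
  (measurable_fst.edist measurable_snd).pow_const p

theorem MK_comm_le {p : ℝ} (μ ν : Measure Y) : MK p μ ν ≤ MK p ν μ := by
  refine le_iInf₂ fun γ hγ => ?_
  refine (MK_le_of_coupling (γ.map Prod.swap) ?_ ?_).trans ?_
  · rw [Measure.map_map measurable_fst measurable_swap]; exact hγ.2
  · rw [Measure.map_map measurable_snd measurable_swap]; exact hγ.1
  · rw [lintegral_map measurable_cost measurable_swap]
    simp [edist_comm]

theorem MK_comm {p : ℝ} (μ ν : Measure Y) : MK p μ ν = MK p ν μ :=
  le_antisymm (MK_comm_le _ _) (MK_comm_le _ _)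

theorem MK_triangle {p : ℝ} (hp : 1 ≤ p) (μ ν ρ : Measure Y) [IsProbabilityMeasure ν] :
    MK p μ ρ ≤ MK p μ ν + MK p ν ρ := by
  have hne : Nonempty Y := ν.nonempty_of_neZero
  have key : ∀ γ₁ γ₂ : Measure (Y × Y),
      (γ₁.map Prod.fst = μ ∧ γ₁.map Prod.snd = ν) →
      (γ₂.map Prod.fst = ν ∧ γ₂.map Prod.snd = ρ) →
      MK p μ ρ ≤ (∫⁻ z, edist z.1 z.2 ^ p ∂γ₁) ^ (1 / p)
        + (∫⁻ z, edist z.1 z.2 ^ p ∂γ₂) ^ (1 / p) := by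
    rintro γ₁ γ₂ ⟨h11, h12⟩ ⟨h21, h22⟩
    have i1 : IsProbabilityMeasure γ₁ := by
      constructor
      rw [← Set.preimage_univ (f := (Prod.snd : Y × Y → Y)),
        ← Measure.map_apply measurable_snd MeasurableSet.univ, h12]
      exact measure_univ
    have i2 : IsProbabilityMeasure γ₂ := by
      constructor
      rw [← Set.preimage_univ (f := (Prod.fst : Y × Y → Y)),
        ← Measure.map_apply measurable_fst MeasurableSet.univ, h21]
      exact measure_univ
    have hdis : ν ⊗ₘ γ₂.condKernel = γ₂ := by
      have := γ₂.disintegrate γ₂.condKernel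
      rwa [Measure.fst, h21] at this
    let κ : Kernel (Y × Y) Y := γ₂.condKernel.comap Prod.snd measurable_snd
    let π : Measure ((Y × Y) × Y) := γ₁ ⊗ₘ κ
    have hπ1 : π.map Prod.fst = γ₁ := Measure.fst_compProd γ₁ κ
    have hm : Measurable (fun z : (Y × Y) × Y => (z.1.2, z.2)) := by fun_prop
    have hm' : Measurable (fun z : (Y × Y) × Y => (z.1.1, z.2)) := by fun_prop
    have hπ2 : π.map (fun z => (z.1.2, z.2)) = γ₂ := by
      conv_rhs => rw [← hdis]
      ext s hs
      rw [Measure.map_apply hm hs, Measure.compProd_apply (hm hs), Measure.compProd_apply hs,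
        ← h12, lintegral_map (Kernel.measurable_kernel_prodMk_left hs) measurable_snd]
      rfl
    have hb := MK_le_of_coupling (p := p) (μ := μ) (ν := ρ) (π.map (fun z => (z.1.1, z.2)))
      (by
        rw [Measure.map_map measurable_fst hm', ← h11, ← hπ1,
          Measure.map_map measurable_fst measurable_fst]
        rfl)
      (by
        rw [Measure.map_map measurable_snd hm', ← h22, ← hπ2,
          Measure.map_map measurable_snd hm]
        rfl)
    refine hb.trans ?_
    rw [lintegral_map measurable_cost hm']
    have e1 : ∫⁻ z, edist z.1 z.2 ^ p ∂γ₁ = ∫⁻ z, edist z.1.1 z.1.2 ^ p ∂π := by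
      rw [← hπ1, lintegral_map measurable_cost measurable_fst]
    have e2 : ∫⁻ z, edist z.1 z.2 ^ p ∂γ₂ = ∫⁻ z, edist z.1.2 z.2 ^ p ∂π := by
      conv_lhs => rw [← hπ2]
      rw [lintegral_map measurable_cost hm]
    rw [e1, e2]
    refine le_trans ?_ (ENNReal.lintegral_Lp_add_le
      (f := fun z : (Y × Y) × Y => edist z.1.1 z.1.2)
      (g := fun z : (Y × Y) × Y => edist z.1.2 z.2) ?_ ?_ hp)
    · have : 0 ≤ 1 / p := by positivity
      gcongr with z
      exact edist_triangle _ _ _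
    · exact (by fun_prop : Measurable _).aemeasurable
    · exact (by fun_prop : Measurable _).aemeasurable
  simp only [MK, ENNReal.iInf_add, ENNReal.add_iInf]
  refine le_iInf₂ fun γ₁ h₁ => le_iInf₂ fun γ₂ h₂ => ?_
  exact key _ _ ‹_› ‹_›

/-- Measurability passes to limits in the Monge-Kantorovich distance. -/
theorem aemeasurable_MK_of_tendsto {Ω : Type*} [MeasurableSpace Ω] {σ : Measure Ω}
    {p : ℝ} (hp : 1 ≤ p) (μ : Measure Y) (ξ : Ω → Measure Y) (R : ℕ → Ω → Measure Y)
    (hξ : ∀ ω, IsProbabilityMeasure (ξ ω)) (hR : ∀ n ω, IsProbabilityMeasure (R n ω))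
    (hm : ∀ n, AEMeasurable (fun ω => MK p μ (R n ω)) σ)
    (hlim : ∀ᵐ ω ∂σ, Tendsto (fun n => MK p (ξ ω) (R n ω)) atTop (𝓝 0)) :
    AEMeasurable (fun ω => MK p μ (ξ ω)) σ := by
  refine aemeasurable_of_tendsto_metrizable_ae' hm ?_
  filter_upwards [hlim] with ω hω
  have hl : Tendsto (fun n => MK p μ (ξ ω) - MK p (ξ ω) (R n ω)) atTop
      (𝓝 (MK p μ (ξ ω))) := by
    have := ENNReal.Tendsto.sub (tendsto_const_nhds (x := MK p μ (ξ ω))) hω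
      (Or.inr ENNReal.zero_ne_top)
    simpa using this
  have hu : Tendsto (fun n => MK p μ (ξ ω) + MK p (ξ ω) (R n ω)) atTop
      (𝓝 (MK p μ (ξ ω))) := by
    simpa using (tendsto_const_nhds (x := MK p μ (ξ ω))).add hω
  refine tendsto_of_tendsto_of_tendsto_of_le_of_le hl hu (fun n => ?_) (fun n => ?_)
  · have := hR n ω
    have h := MK_triangle hp μ (R n ω) (ξ ω)
    rw [MK_comm (R n ω)] at h
    exact tsub_le_iff_right.2 h
  · exact MK_triangle hp μ (ξ ω) (R n ω)

theorem MK_map_le {p : ℝ} (ν : Measure Y) {T : Y → Y} (hT : Measurable T) :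
    MK p ν (ν.map T) ≤ (∫⁻ y, edist y (T y) ^ p ∂ν) ^ (1 / p) := by
  have hm : Measurable (fun y => (y, T y)) := by fun_prop
  refine (MK_le_of_coupling (ν.map (fun y => (y, T y))) ?_ ?_).trans ?_
  · rw [Measure.map_map measurable_fst hm]; exact Measure.map_id
  · rw [Measure.map_map measurable_snd hm]; rfl
  · rw [lintegral_map measurable_cost hm]

theorem MK_move_le {p : ℝ} (hp : 1 ≤ p) (α β : Measure Y) (y0 : Y) :
    MK p (α + β) (α + β Set.univ • Measure.dirac y0)
      ≤ (∫⁻ y, edist y y0 ^ p ∂β) ^ (1 / p) := by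
  have hm1 : Measurable (fun y : Y => (y, y)) := by fun_prop
  have hm2 : Measurable (fun y : Y => (y, y0)) := by fun_prop
  refine (MK_le_of_coupling (α.map (fun y => (y, y)) + β.map (fun y => (y, y0))) ?_ ?_).trans ?_
  · rw [Measure.map_add _ _ measurable_fst, Measure.map_map measurable_fst hm1,
      Measure.map_map measurable_fst hm2]
    congr 1 <;> exact Measure.map_id
  · rw [Measure.map_add _ _ measurable_snd, Measure.map_map measurable_snd hm1,
      Measure.map_map measurable_snd hm2]
    congr 1
    · exact Measure.map_id
    · exact Measure.map_const β y0
  · rw [lintegral_add_measure, lintegral_map measurable_cost hm1,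
      lintegral_map measurable_cost hm2]
    simp [ENNReal.zero_rpow_of_pos (by linarith : 0 < p)]

/-- The discrete approximating measure with weights `v i / (M+1)` on the points of `s`, the
remaining mass being put at `y0`. -/
noncomputable def discMeasure (y0 : Y) (s : Finset Y) (M : ℕ) (v : s → ℕ) : Measure Y :=
  ∑ i, ((v i : ℝ≥0∞) / (M + 1 : ℕ)) • Measure.dirac (i : Y)
    + (1 - ∑ i, ((v i : ℝ≥0∞) / (M + 1 : ℕ))) • Measure.dirac y0

theorem map_simpleFunc_eq (ν : Measure Y) (T : SimpleFunc Y Y) :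
    ν.map T = ∑ i : T.range, ν (T ⁻¹' {(i : Y)}) • Measure.dirac (i : Y) := by
  ext s hs
  rw [Measure.map_apply T.measurable hs]
  simp only [Measure.coe_finsetSum, Finset.sum_apply, Measure.smul_apply, smul_eq_mul,
    Measure.dirac_apply' _ hs]
  rw [Finset.sum_coe_sort T.range (fun i => ν (T ⁻¹' {i}) * s.indicator 1 i)]
  have h := lintegral_map (μ := ν) (f := s.indicator (1 : Y → ℝ≥0∞)) (g := T)
    (measurable_one.indicator hs) T.measurable
  rw [lintegral_indicator_one hs, Measure.map_apply T.measurable hs] at h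
  rw [h]
  have := SimpleFunc.map_lintegral (μ := ν) (s.indicator (1 : Y → ℝ≥0∞)) T
  rw [← SimpleFunc.lintegral_eq_lintegral] at this
  simp only [SimpleFunc.map_apply] at this
  rw [this]
  exact Finset.sum_congr rfl fun i _ => mul_comm _ _

/-- Weight codes. -/
noncomputable def code (M : ℕ) (b : ℝ≥0∞) : ℕ := ⌊((M + 1 : ℕ) * b).toReal⌋₊

theorem measurable_code (M : ℕ) : Measurable (code M) := by
  unfold code
  exact Nat.measurable_floor.comp (by fun_prop)

theorem code_le (M : ℕ) {b : ℝ≥0∞} (hb : b ≠ ∞) :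
    (code M b : ℝ≥0∞) / (M + 1 : ℕ) ≤ b := by
  refine ENNReal.div_le_of_le_mul' ?_
  have hfin : ((M + 1 : ℕ) : ℝ≥0∞) * b ≠ ∞ := ENNReal.mul_ne_top (by simp) hb
  rw [← ENNReal.ofReal_toReal hfin, ← ENNReal.ofReal_natCast]
  exact ENNReal.ofReal_le_ofReal (Nat.floor_le ENNReal.toReal_nonneg)

theorem le_code (M : ℕ) {b : ℝ≥0∞} (hb : b ≠ ∞) :
    b - (code M b : ℝ≥0∞) / (M + 1 : ℕ) ≤ 1 / (M + 1 : ℕ) := by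
  rw [tsub_le_iff_right, ← ENNReal.add_div]
  rw [ENNReal.le_div_iff_mul_le (by simp) (by simp)]
  have hfin : ((M + 1 : ℕ) : ℝ≥0∞) * b ≠ ∞ := ENNReal.mul_ne_top (by simp) hb
  rw [mul_comm, ← ENNReal.ofReal_toReal hfin]
  refine (ENNReal.ofReal_le_ofReal (Nat.lt_floor_add_one _).le).trans ?_
  rw [ENNReal.ofReal_add (by positivity) zero_le_one, ENNReal.ofReal_natCast, add_comm]
  simp [code]

theorem sum_weights (ν : Measure Y) [IsProbabilityMeasure ν] (T : SimpleFunc Y Y) :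
    ∑ i : T.range, ν (T ⁻¹' {(i : Y)}) = 1 := by
  have h := congrArg (fun m : Measure Y => m Set.univ) (map_simpleFunc_eq ν T)
  simp only [Measure.map_apply T.measurable MeasurableSet.univ] at h
  simpa using h.symm

theorem isProb_disc (y0 : Y) (s : Finset Y) (M : ℕ) (v : s → ℕ)
    (h : ∑ i, ((v i : ℝ≥0∞) / (M + 1 : ℕ)) ≤ 1) :
    IsProbabilityMeasure (discMeasure y0 s M v) := by
  constructor
  simp only [discMeasure, Measure.add_apply, Measure.coe_finsetSum, Finset.sum_apply,
    Measure.smul_apply, smul_eq_mul, measure_univ, mul_one]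
  exact add_tsub_cancel_of_le h

theorem MK_disc_le {p : ℝ} (hp : 1 ≤ p) (y0 : Y) (ν : Measure Y) [IsProbabilityMeasure ν]
    (T : SimpleFunc Y Y) (M : ℕ) :
    MK p (ν.map T) (discMeasure y0 T.range M (fun i => code M (ν (T ⁻¹' {(i : Y)}))))
      ≤ ((1 / (M + 1 : ℕ) : ℝ≥0∞) * ∑ i : T.range, edist (i : Y) y0 ^ p) ^ (1 / p) := by
  set b : T.range → ℝ≥0∞ := fun i => ν (T ⁻¹' {(i : Y)}) with hb
  set c : T.range → ℝ≥0∞ := fun i => (code M (b i) : ℝ≥0∞) / (M + 1 : ℕ) with hc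
  have hcb : ∀ i, c i ≤ b i := fun i => code_le M (measure_ne_top _ _)
  have hsb : ∑ i, b i = 1 := sum_weights ν T
  have hsc : ∑ i, c i ≤ 1 := hsb ▸ Finset.sum_le_sum fun i _ => hcb i
  have h := MK_move_le hp (∑ i, c i • Measure.dirac (i : Y))
    (∑ i, (b i - c i) • Measure.dirac (i : Y)) y0
  have e1 : ∑ i, c i • Measure.dirac (i : Y) + ∑ i, (b i - c i) • Measure.dirac (i : Y)
      = ν.map T := by
    rw [map_simpleFunc_eq, ← Finset.sum_add_distrib]
    refine Finset.sum_congr rfl fun i _ => ?_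
    rw [← add_smul, add_tsub_cancel_of_le (hcb i)]
  have e2 : (∑ i, (b i - c i) • Measure.dirac (i : Y) : Measure Y) Set.univ = 1 - ∑ i, c i := by
    simp only [Measure.coe_finsetSum, Finset.sum_apply,
      Measure.smul_apply, smul_eq_mul, measure_univ, mul_one]
    refine ENNReal.eq_sub_of_add_eq (ne_top_of_le_ne_top ENNReal.one_ne_top hsc) ?_
    rw [← Finset.sum_add_distrib, ← hsb]
    exact Finset.sum_congr rfl fun i _ => tsub_add_cancel_of_le (hcb i)
  rw [e1, e2] at h
  refine h.trans ?_
  have : 0 ≤ 1 / p := by positivity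
  refine ENNReal.rpow_le_rpow ?_ this
  rw [lintegral_finsetSum_measure, Finset.mul_sum]
  refine Finset.sum_le_sum fun i _ => ?_
  rw [lintegral_smul_measure, lintegral_dirac, smul_eq_mul]
  gcongr
  exact le_code M (measure_ne_top _ _)

theorem aemeasurable_MK_map {Ω : Type*} [MeasurableSpace Ω] {σ : Measure Ω}
    {p : ℝ} (hp : 1 ≤ p) (y0 : Y) (μ : Measure Y) (η : Kernel Ω Y) [IsMarkovKernel η]
    (T : SimpleFunc Y Y) :
    AEMeasurable (fun ω => MK p μ ((η ω).map T)) σ := by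
  refine aemeasurable_MK_of_tendsto hp μ _
    (fun M ω => discMeasure y0 T.range M (fun i => code M (η ω (T ⁻¹' {(i : Y)}))))
    (fun ω => Measure.isProbabilityMeasure_map T.measurable.aemeasurable) ?_ ?_ ?_
  · intro M ω
    refine isProb_disc _ _ _ _ ?_
    rw [← sum_weights (η ω) T]
    exact Finset.sum_le_sum fun i _ => code_le M (measure_ne_top _ _)
  · intro M
    have h1 : Measurable (fun ω => (fun i : T.range => code M (η ω (T ⁻¹' {(i : Y)})))) :=
      measurable_pi_lambda _ fun i => (measurable_code M).comp
        (η.measurable_coe (T.measurableSet_fiber _))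
    exact ((measurable_of_countable
      (fun v : T.range → ℕ => MK p μ (discMeasure y0 T.range M v))).comp h1).aemeasurable
  · refine Eventually.of_forall fun ω => ?_
    refine tendsto_of_tendsto_of_tendsto_of_le_of_le tendsto_const_nhds ?_
      (fun _ => zero_le) (fun M => MK_disc_le hp y0 (η ω) T M)
    have hp' : 0 < 1 / p := by positivity
    have hS : ∑ i : T.range, edist (i : Y) y0 ^ p ≠ ∞ := by
      refine (ENNReal.sum_lt_top.2 fun i _ => ?_).ne
      exact ENNReal.rpow_lt_top_of_nonneg (by linarith) (edist_ne_top _ _)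
    have h1 : Tendsto (fun M : ℕ => (1 / (M + 1 : ℕ) : ℝ≥0∞)) atTop (𝓝 0) := by
      simpa using (tendsto_add_atTop_iff_nat 1).2 ENNReal.tendsto_inv_nat_nhds_zero
    have h2 := ENNReal.Tendsto.mul_const h1 (Or.inr hS)
    have h3 := (ENNReal.continuous_rpow_const (y := 1 / p)).tendsto _ |>.comp h2
    simpa [Function.comp_def, ENNReal.zero_rpow_of_pos (by linarith : 0 < p),
      show 0 < p by linarith] using h3

theorem aemeasurable_MK_kernel {Ω : Type*} [MeasurableSpace Ω] {σ : Measure Ω}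
    {p : ℝ} (hp : 1 ≤ p) (y0 : Y) (μ : Measure Y) (η : Kernel Ω Y) [IsMarkovKernel η]
    (hη : ∀ᵐ ω ∂σ, FiniteMoment p y0 (η ω)) :
    AEMeasurable (fun ω => MK p μ (η ω)) σ := by
  let T : ℕ → SimpleFunc Y Y := fun n =>
    SimpleFunc.approxOn id measurable_id Set.univ y0 (Set.mem_univ _) n
  refine aemeasurable_MK_of_tendsto hp μ (fun ω => η ω) (fun n ω => (η ω).map (T n))
    (fun ω => inferInstance)
    (fun n ω => Measure.isProbabilityMeasure_map (T n).measurable.aemeasurable)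
    (fun n => aemeasurable_MK_map hp y0 μ η (T n)) ?_
  filter_upwards [hη] with ω hω
  refine tendsto_of_tendsto_of_tendsto_of_le_of_le tendsto_const_nhds ?_
      (fun _ => zero_le) (fun n => MK_map_le (η ω) (T n).measurable)
  have hp0 : 0 < p := by linarith
  have h2 : Tendsto (fun n => ∫⁻ y, edist y (T n y) ^ p ∂(η ω)) atTop
      (𝓝 (∫⁻ _, 0 ∂(η ω))) := by
    refine tendsto_lintegral_of_dominated_convergence (fun y => edist y0 y ^ p) ?_ ?_ hω ?_
    · intro n
      exact (measurable_id.edist (T n).measurable).pow_const p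
    · intro n
      refine Eventually.of_forall fun y => ?_
      refine ENNReal.rpow_le_rpow ?_ hp0.le
      rw [edist_comm]
      exact SimpleFunc.edist_approxOn_le measurable_id (Set.mem_univ y0) y n
    · refine Eventually.of_forall fun y => ?_
      have ht : Tendsto (fun n => T n y) atTop (𝓝 y) :=
        SimpleFunc.tendsto_approxOn measurable_id (Set.mem_univ y0) (by simp)
      have h3 := (ENNReal.continuous_rpow_const (y := p)).tendsto _ |>.comp
        ((tendsto_const_nhds (x := y)).edist ht)
      simpa [Function.comp_def, hp0] using h3
  have h3 := (ENNReal.continuous_rpow_const (y := 1 / p)).tendsto _ |>.comp h2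
  simpa [Function.comp_def, hp0] using h3

theorem MK_dirac_le {p : ℝ} (y0 : Y) (ν : Measure Y) [IsProbabilityMeasure ν] :
    MK p (Measure.dirac y0) ν ≤ (∫⁻ y, edist y0 y ^ p ∂ν) ^ (1 / p) := by
  have hm : Measurable (fun y : Y => (y0, y)) := by fun_prop
  refine (MK_le_of_coupling (ν.map (fun y => (y0, y))) ?_ ?_).trans ?_
  · rw [Measure.map_map measurable_fst hm]
    exact (Measure.map_const ν y0).trans (by simp)
  · rw [Measure.map_map measurable_snd hm]; exact Measure.map_id
  · rw [lintegral_map measurable_cost hm]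

theorem le_MK_dirac {p : ℝ} (y0 : Y) (ν : Measure Y) :
    (∫⁻ y, edist y0 y ^ p ∂ν) ^ (1 / p) ≤ MK p (Measure.dirac y0) ν := by
  refine le_iInf₂ fun γ hγ => le_of_eq ?_
  congr 1
  have hme : Measurable (fun y : Y => edist y0 y ^ p) :=
    (measurable_const.edist measurable_id).pow_const p
  rw [← hγ.2, lintegral_map hme measurable_snd]
  refine lintegral_congr_ae ?_
  have h : ∀ᵐ y ∂(γ.map Prod.fst), y = y0 := by
    rw [hγ.1]
    exact (ae_dirac_iff (p := fun y => y = y0) (measurableSet_singleton y0)).2 rfl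
  have h' := ae_of_ae_map measurable_fst.aemeasurable h
  filter_upwards [h'] with z hz
  rw [hz]

theorem MK_dirac_eq {p : ℝ} (y0 : Y) (ν : Measure Y) [IsProbabilityMeasure ν] :
    MK p (Measure.dirac y0) ν = (∫⁻ y, edist y0 y ^ p ∂ν) ^ (1 / p) :=
  le_antisymm (MK_dirac_le _ _) (le_MK_dirac _ _)

theorem finiteMoment_ae {Ω : Type*} [MeasurableSpace Ω] {σ : Measure Ω}
    {p : ℝ} (hp : 1 ≤ p) {q : ℝ≥0∞} (hq : 1 ≤ q) (y0 : Y) (η : Kernel Ω Y)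
    (h : MemP p q σ y0 η) : ∀ᵐ ω ∂σ, FiniteMoment p y0 (η ω) := by
  obtain ⟨hM, h⟩ := h
  have hp0 : 0 < p := by linarith
  have hfin : ∀ ω, MK p (Measure.dirac y0) (η ω) < ∞ → FiniteMoment p y0 (η ω) := by
    intro ω hω hc
    rw [MK_dirac_eq, hc] at hω
    simp [hp0] at hω
  suffices hs : ∀ᵐ ω ∂σ, MK p (Measure.dirac y0) (η ω) < ∞ from hs.mono hfin
  unfold scrMK at h
  simp only [Kernel.const_apply] at h
  split_ifs at h with hqt
  · filter_upwards [ENNReal.ae_le_essSup (μ := σ)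
      (fun ω => MK p (Measure.dirac y0) (η ω))] with ω hω
    exact hω.trans_lt h.lt_top
  · have hq0 : 0 < q.toReal := ENNReal.toReal_pos (by positivity) hqt
    have hmeas : Measurable (fun ω => MK p (Measure.dirac y0) (η ω) ^ q.toReal) := by
      simp only [MK_dirac_eq]
      have h1 : Measurable (fun ω => ∫⁻ y, edist y0 y ^ p ∂(η ω)) :=
        Measurable.lintegral_kernel ((measurable_const.edist measurable_id).pow_const p)
      exact (h1.pow_const _).pow_const _
    have hI : ∫⁻ ω, MK p (Measure.dirac y0) (η ω) ^ q.toReal ∂σ ≠ ∞ := by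
      intro hc
      rw [hc] at h
      simp [hq0] at h
    filter_upwards [ae_lt_top hmeas hI] with ω hω
    by_contra hc
    rw [not_lt, top_le_iff] at hc
    rw [hc] at hω
    simp [hq0] at hω

theorem scrMK_const {Ω : Type*} [MeasurableSpace Ω] {σ : Measure Ω} [IsProbabilityMeasure σ]
    {p : ℝ} {q : ℝ≥0∞} (hq : 1 ≤ q) (μ ν : Measure Y) :
    scrMK p q σ (Kernel.const Ω μ) (Kernel.const Ω ν) = MK p μ ν := by
  unfold scrMK
  simp only [Kernel.const_apply]
  split_ifs with hqt
  · exact essSup_const _ (IsProbabilityMeasure.ne_zero σ)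
  · have hq0 : 0 < q.toReal := ENNReal.toReal_pos (by positivity) hqt
    rw [lintegral_const, measure_univ, mul_one, ← ENNReal.rpow_mul, mul_one_div_cancel hq0.ne',
      ENNReal.rpow_one]

theorem lintegral_le_scrMK {Ω : Type*} [MeasurableSpace Ω] {σ : Measure Ω}
    [IsProbabilityMeasure σ] {p : ℝ} {q : ℝ≥0∞} (hq : 1 ≤ q) (κ η : Kernel Ω Y)
    (hm : AEMeasurable (fun ω => MK p (κ ω) (η ω)) σ) :
    ∫⁻ ω, MK p (κ ω) (η ω) ∂σ ≤ scrMK p q σ κ η := by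
  have h := eLpNorm_le_eLpNorm_of_exponent_le hq hm.aestronglyMeasurable
  rw [eLpNorm_one_eq_lintegral_enorm] at h
  unfold scrMK
  split_ifs with hqt
  · rw [hqt, eLpNorm_exponent_top] at h
    exact h
  · rw [eLpNorm_eq_lintegral_rpow_enorm_toReal (by positivity) hqt] at h
    exact h

end Aux

/-- **Fiberwise-constant classical barycenters are disintegrated barycenters** on the
trivial bundle `Ω × Y`: if `ν0` minimizes `ν ↦ ∑ k λ_k MK_p(μ_k, ν)` over `𝒫_p(Y)`, then
the product measure `σ ⊗ ν0` (encoded by the constant kernel at `ν0`) belongs to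
`𝒫^σ_{p,q}(Ω × Y)` and minimizes `n ↦ ∑ k λ_k scrMK_{p,q}(σ ⊗ μ_k, n)` over
`𝒫^σ_{p,q}(Ω × Y)`. -/
theorem fiberwise_constant_barycenter
    {Ω : Type*} [MetricSpace Ω] [CompleteSpace Ω] [SecondCountableTopology Ω]
    [MeasurableSpace Ω] [BorelSpace Ω]
    {Y : Type*} [MetricSpace Y] [CompleteSpace Y] [SecondCountableTopology Y]
    [MeasurableSpace Y] [BorelSpace Y]
    (σ : Measure Ω) [IsProbabilityMeasure σ] (y0 : Y)
    (p : ℝ) (hp : 1 ≤ p) (q : ℝ≥0∞) (hq : 1 ≤ q)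
    (K : ℕ) (hK : 2 ≤ K)
    (lam : Fin K → ℝ) (hlam : ∀ k, lam k ∈ Set.Ioo (0 : ℝ) 1) (hsum : ∑ k, lam k = 1)
    (μ : Fin K → Measure Y) (hprob : ∀ k, IsProbabilityMeasure (μ k))
    (hmom : ∀ k, FiniteMoment p y0 (μ k))
    (ν0 : Measure Y) (hν0 : IsProbabilityMeasure ν0) (hν0mom : FiniteMoment p y0 ν0)
    (hν0min : ∀ ρ : Measure Y, IsProbabilityMeasure ρ → FiniteMoment p y0 ρ →
      ∑ k, ENNReal.ofReal (lam k) * MK p (μ k) ν0 ≤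
        ∑ k, ENNReal.ofReal (lam k) * MK p (μ k) ρ) :
    MemP p q σ y0 (Kernel.const Ω ν0) ∧
      ∀ η : Kernel Ω Y, MemP p q σ y0 η →
        ∑ k, ENNReal.ofReal (lam k) *
            scrMK p q σ (Kernel.const Ω (μ k)) (Kernel.const Ω ν0) ≤
          ∑ k, ENNReal.ofReal (lam k) * scrMK p q σ (Kernel.const Ω (μ k)) η := by
  have hp0 : 0 < p := by linarith
  refine ⟨⟨inferInstance, ?_⟩, ?_⟩
  · rw [scrMK_const hq, MK_dirac_eq]
    exact ENNReal.rpow_ne_top_of_nonneg (by positivity) hν0mom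
  · intro η hη
    have hM : IsMarkovKernel η := hη.1
    have hfm := finiteMoment_ae hp hq y0 η hη
    have hmeas : ∀ k, AEMeasurable (fun ω => MK p (μ k) (η ω)) σ := fun k =>
      aemeasurable_MK_kernel hp y0 (μ k) η hfm
    simp only [scrMK_const hq]
    calc ∑ k, ENNReal.ofReal (lam k) * MK p (μ k) ν0
        = ∫⁻ _, ∑ k, ENNReal.ofReal (lam k) * MK p (μ k) ν0 ∂σ := by simp
      _ ≤ ∫⁻ ω, ∑ k, ENNReal.ofReal (lam k) * MK p (μ k) (η ω) ∂σ := by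
          refine lintegral_mono_ae ?_
          filter_upwards [hfm] with ω hω
          exact hν0min (η ω) inferInstance hω
      _ = ∑ k, ENNReal.ofReal (lam k) * ∫⁻ ω, MK p (μ k) (η ω) ∂σ := by
          rw [lintegral_finsetSum' _ fun k _ => (hmeas k).const_mul _]
          exact Finset.sum_congr rfl fun k _ => lintegral_const_mul'' _ (hmeas k)
      _ ≤ _ := by
          refine Finset.sum_le_sum fun k _ => ?_
          gcongr
          exact lintegral_le_scrMK hq (Kernel.const Ω (μ k)) η (hmeas k)
end

section
/- Let d ≥ 1, p > 1, and λ ∈ (0,1]. Let φ : ℝ^d → ℝ and ψ : ℝ^d → (−∞,∞] satisfy φ(t) ≥ −λ‖t−s‖^p − ψ(s) for all t, s ∈ ℝ^d (Euclidean norm). Suppose t_0, s_0 ∈ ℝ^d with s_0 ≠ t_0 satisfy φ(t_0) = −λ‖t_0−s_0‖^p − ψ(s_0), and that φ is Fréchet differentiable at t_0 with gradient ∇φ(t_0). Then ∇φ(t_0) ≠ 0 and s_0 = t_0 + (‖∇φ(t_0)‖/(pλ))^{1/(p−1)} · ∇φ(t_0)/‖∇φ(t_0)‖. -/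
/-- **Identification of the optimally paired point from a dual potential** (Euclidean
case).  Suppose `φ : ℝ^d → ℝ` and `ψ : ℝ^d → (-∞,∞]` satisfy
`φ(t) ≥ -λ‖t-s‖^p - ψ(s)` for all `t, s`, with equality at `(t0, s0)` where `s0 ≠ t0`,
and `φ` is differentiable at `t0` with gradient `g = ∇φ(t0)`.  Then `g ≠ 0` and
`s0 = t0 + (‖g‖/(pλ))^{1/(p-1)} · g/‖g‖`. -/
theorem dual_potential_pairing (d : ℕ) (hd : 1 ≤ d) (p : ℝ) (hp : 1 < p)
    (lam : ℝ) (hlam : lam ∈ Set.Ioc (0 : ℝ) 1)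
    (φ : EuclideanSpace ℝ (Fin d) → ℝ) (ψ : EuclideanSpace ℝ (Fin d) → EReal)
    (hineq : ∀ t s : EuclideanSpace ℝ (Fin d),
      (((-(lam * ‖t - s‖ ^ p)) : ℝ) : EReal) - ψ s ≤ ((φ t : ℝ) : EReal))
    (t0 s0 : EuclideanSpace ℝ (Fin d)) (hne : s0 ≠ t0)
    (heq : ((φ t0 : ℝ) : EReal) = (((-(lam * ‖t0 - s0‖ ^ p)) : ℝ) : EReal) - ψ s0)
    (g : EuclideanSpace ℝ (Fin d)) (hg : HasGradientAt φ g t0) :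
    g ≠ 0 ∧ s0 = t0 + (((‖g‖ / (p * lam)) ^ (1 / (p - 1) : ℝ)) / ‖g‖) • g := by
  have hl : 0 < lam := hlam.1
  obtain ⟨c, hc⟩ : ∃ c : ℝ, ψ s0 = (c : EReal) := by
    induction h : ψ s0 using EReal.rec with
    | bot => rw [h, EReal.coe_sub_bot] at heq; exact absurd heq (EReal.coe_ne_top _)
    | top => rw [h] at heq; simp at heq
    | coe c => exact ⟨c, rfl⟩
  have h0 : φ t0 = -(lam * ‖t0 - s0‖ ^ p) - c := by
    rw [hc] at heq
    exact_mod_cast heq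
  have h1 : ∀ t, -(lam * ‖t - s0‖ ^ p) - c ≤ φ t := by
    intro t
    have := hineq t s0
    rw [hc] at this
    exact_mod_cast this
  have hmin : IsLocalMin (fun t => φ t + lam * ‖t - s0‖ ^ p) t0 := by
    refine Filter.Eventually.of_forall fun t => ?_
    have := h1 t
    simp only
    linarith
  have hr : 0 < ‖t0 - s0‖ := norm_pos_iff.2 (sub_ne_zero.2 hne.symm)
  have hd1 := (hasFDerivAt_norm_rpow (t0 - s0) hp).comp t0 ((hasFDerivAt_id t0).sub_const s0)
  have hz := hmin.hasFDerivAt_eq_zero (hg.hasFDerivAt.add (hd1.const_mul lam))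
  have hgv : g = (lam * p * ‖t0 - s0‖ ^ (p - 2)) • (s0 - t0) := by
    refine ext_inner_right ℝ fun v => ?_
    have := congrArg (fun L => L v) hz
    simp at this
    rw [inner_smul_left, ← neg_sub t0 s0, inner_neg_left, inner_sub_left]
    simp
    linarith
  rw [norm_sub_rev] at hr hgv
  set r := ‖s0 - t0‖ with hrdef
  have hp0 : 0 < p := by linarith
  have hk : 0 < lam * p * r ^ (p - 2) := by positivity
  have hpow : r ^ (p - 2) * r = r ^ (p - 1) := by
    rw [← Real.rpow_add_one hr.ne']
    congr 1
    ring
  have hng : ‖g‖ = lam * p * r ^ (p - 2) * r := by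
    rw [hgv, norm_smul, Real.norm_of_nonneg hk.le]
  have hgpos : 0 < ‖g‖ := by rw [hng]; positivity
  refine ⟨norm_pos_iff.1 hgpos, ?_⟩
  have h2 : ‖g‖ / (p * lam) = r ^ (p - 1) := by
    rw [hng, ← hpow]
    field_simp
  have h3 : (‖g‖ / (p * lam)) ^ (1 / (p - 1) : ℝ) = r := by
    rw [h2, ← Real.rpow_mul hr.le, mul_one_div_cancel (by linarith), Real.rpow_one]
  rw [h3, hng, hgv, smul_smul]
  have h4 : r / (lam * p * r ^ (p - 2) * r) * (lam * p * r ^ (p - 2)) = 1 := by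
    field_simp
  rw [h4, one_smul]
  abel
end
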